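/- Let b(k,m) be the number of DS-surjections f of arity k and degree m with f(1) ≠ f(m+k) ('black cacti'), and w(k,m) the number of those with f(1) = f(m+k) ('white cacti'); set B(x,t) = Σ_{k≥1,m≥0} (b(k,m)/k!) x^k t^m and W(x,t) = Σ_{k≥1,m≥0} (w(k,m)/k!) x^k t^m in ℚ[[x,t]]. Then P = B + W, B·(1 − W) = W², and W·(1 − t·P) = x. -/

import Mathlib

/-- A DS-surjection of arity `k` and degree `m` (0-indexed encoding). -/
def IsDSSurjection (k m : ℕ) (f : Fin (m + k) → Fin k) : Prop :=
  Function.Surjective f ∧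
  (∀ a : ℕ, ∀ ha : a + 1 < m + k, f ⟨a, by omega⟩ ≠ f ⟨a + 1, ha⟩) ∧
  ¬∃ a b c d : Fin (m + k), a < b ∧ b < c ∧ c < d ∧ f a = f c ∧ f b = f d ∧ f a ≠ f b

/-- `f(1) ≠ f(m+k)`: the condition for a 'black cactus' cell. -/
def IsBlackBoundary (k m : ℕ) (f : Fin (m + k) → Fin k) : Prop :=
  ∀ h : 0 < m + k, f ⟨0, h⟩ ≠ f ⟨m + k - 1, by omega⟩

/-- `f(1) = f(m+k)`: the condition for a 'white cactus' cell. -/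
def IsWhiteBoundary (k m : ℕ) (f : Fin (m + k) → Fin k) : Prop :=
  ∀ h : 0 < m + k, f ⟨0, h⟩ = f ⟨m + k - 1, by omega⟩

/-- `b(k,m)`: the number of black DS-surjections of arity `k`, degree `m`. -/
noncomputable def blackCount (k m : ℕ) : ℕ :=
  Nat.card {f : Fin (m + k) → Fin k // IsDSSurjection k m f ∧ IsBlackBoundary k m f}

/-- `w(k,m)`: the number of white DS-surjections of arity `k`, degree `m`. -/
noncomputable def whiteCount (k m : ℕ) : ℕ :=
  Nat.card {f : Fin (m + k) → Fin k // IsDSSurjection k m f ∧ IsWhiteBoundary k m f}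

/-- `c(k,m)`: the number of all DS-surjections of arity `k`, degree `m`. -/
noncomputable def dsCount (k m : ℕ) : ℕ :=
  Nat.card {f : Fin (m + k) → Fin k // IsDSSurjection k m f}

/-- `P(x,t) = Σ_{k≥1,m≥0} (c(k,m)/k!) x^k t^m`, with `x` = variable `0`, `t` = variable `1`. -/
noncomputable def cactiGF : MvPowerSeries (Fin 2) ℚ :=
  fun d => if d 0 = 0 then 0 else (dsCount (d 0) (d 1) : ℚ) / (Nat.factorial (d 0) : ℚ)

/-- `B(x,t) = Σ_{k≥1,m≥0} (b(k,m)/k!) x^k t^m`. -/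
noncomputable def blackGF : MvPowerSeries (Fin 2) ℚ :=
  fun d => if d 0 = 0 then 0 else (blackCount (d 0) (d 1) : ℚ) / (Nat.factorial (d 0) : ℚ)

/-- `W(x,t) = Σ_{k≥1,m≥0} (w(k,m)/k!) x^k t^m`. -/
noncomputable def whiteGF : MvPowerSeries (Fin 2) ℚ :=
  fun d => if d 0 = 0 then 0 else (whiteCount (d 0) (d 1) : ℚ) / (Nat.factorial (d 0) : ℚ)

/-- Nonempty words without repeated neighbours and without a subword `a b a b`, `a ≠ b`. -/
def IsDSWord (α : Type) (l : List α) : Prop :=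
  l ≠ [] ∧ l.IsChain (· ≠ ·) ∧ ∀ a b, a ≠ b → ¬ [a, b, a, b].Sublist l

/-- Davenport–Schinzel words whose first and last letters agree. -/
def IsWhiteWord (α : Type) (l : List α) : Prop :=
  IsDSWord α l ∧ l.head? = l.getLast?

/-- Davenport–Schinzel words whose first and last letters differ. -/
def IsBlackWord (α : Type) (l : List α) : Prop :=
  IsDSWord α l ∧ l.head? ≠ l.getLast?

/-- Words with a single letter. -/
def IsSingletonWord (α : Type) (l : List α) : Prop := l.length = 1

/-- White words of length at least two. -/
def IsLongWhiteWord (α : Type) (l : List α) : Prop :=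
  IsWhiteWord α l ∧ l.length ≠ 1

section Words

variable {α : Type} {u v l : List α}

lemma IsDSWord.of_isInfix (hl : IsDSWord α l) (hu : u ≠ []) (h : u <:+: l) : IsDSWord α u := by
  refine ⟨hu, ?_, fun a b hab hs => hl.2.2 a b hab (hs.trans h.sublist)⟩
  obtain ⟨s, t, rfl⟩ := h
  exact hl.2.1.left_of_append.right_of_append

lemma IsDSWord.map_iff {β : Type} {f : α → β} (hf : Function.Injective f) :
    IsDSWord β (l.map f) ↔ IsDSWord α l := by
  unfold IsDSWord
  rw [List.isChain_map]
  refine and_congr (by simp) (and_congr (by simp [hf.ne_iff]) ⟨fun h a b hab hs => ?_,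
    fun h a b hab hs => ?_⟩)
  · exact h (f a) (f b) (hf.ne hab) (hs.map f)
  · obtain ⟨l', hl', h'⟩ := List.sublist_map_iff.1 hs
    have hlen : l'.length = 4 := by simpa using (congrArg List.length h').symm
    match l', hlen with
    | [p, q, r, s], _ =>
      simp only [List.map_cons, List.map_nil, List.cons.injEq, and_true] at h'
      obtain ⟨rfl, rfl, h1, h2⟩ := h'
      obtain rfl := hf h1
      obtain rfl := hf h2
      exact h p q (fun e => hab (congrArg f e)) hl'

lemma head?_map_eq_getLast?_map_iff {β : Type} {f : α → β} (hf : Function.Injective f) :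
    (l.map f).head? = (l.map f).getLast? ↔ l.head? = l.getLast? := by
  rw [List.head?_map, List.getLast?_map, (Option.map_injective hf).eq_iff]

lemma IsWhiteWord.eq_cons (h : IsWhiteWord α l) :
    ∃ a, (∃ l', l = a :: l') ∧ ∃ l', l = l' ++ [a] := by
  obtain ⟨⟨hne, -⟩, h⟩ := h
  obtain ⟨a, l', rfl⟩ := List.exists_cons_of_ne_nil hne
  exact ⟨a, ⟨l', rfl⟩, List.getLast?_eq_some_iff.1 h.symm⟩

/-- Concatenation of words over disjoint alphabets. -/
lemma IsDSWord.append (hu : IsDSWord α u) (hv : IsDSWord α v) (h : u.Disjoint v) :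
    IsDSWord α (u ++ v) := by
  refine ⟨by simp [hu.1], List.isChain_append.2 ⟨hu.2.1, hv.2.1, ?_⟩, fun a b hab hs => ?_⟩
  · rintro x hx y hy rfl
    exact h (List.mem_of_getLast? hx) (List.mem_of_head? hy)
  · obtain ⟨l₁, l₂, e, h₁, h₂⟩ := List.sublist_append_iff.1 hs
    have key : ∀ x ∈ l₁, x ∉ l₂ := fun x hx hx' => h (h₁.subset hx) (h₂.subset hx')
    match l₁, e with
    | [], e => exact hv.2.2 a b hab (by simpa [e] using h₂)
    | [_], e => grind
    | [_, _], e => grind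
    | [_, _, _], e => grind
    | [_, _, _, _], e =>
      simp only [List.cons_append, List.nil_append, List.cons.injEq] at e
      obtain ⟨rfl, rfl, rfl, rfl, -⟩ := e
      exact hu.2.2 _ _ hab h₁
    | _ :: _ :: _ :: _ :: _ :: _, e => simp at e

lemma IsBlackWord.append (hu : IsWhiteWord α u) (hv : IsDSWord α v) (h : u.Disjoint v) :
    IsBlackWord α (u ++ v) := by
  refine ⟨hu.1.append hv h, fun e => ?_⟩
  rw [List.head?_append_of_ne_nil _ hu.1.1, List.getLast?_append_of_ne_nil _ hv.1] at e
  obtain ⟨a, ⟨u', rfl⟩, -⟩ := hu.eq_cons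
  exact h (List.mem_cons_self) (List.mem_of_getLast? e.symm)

lemma IsBlackWord.exists_append (hl : IsBlackWord α l) :
    ∃ u v, IsWhiteWord α u ∧ IsDSWord α v ∧ u.Disjoint v ∧ u ++ v = l := by
  obtain ⟨a, l', rfl⟩ := List.exists_cons_of_ne_nil hl.1.1
  obtain ⟨s, t, e, hs⟩ := List.eq_append_cons_of_mem (a := a) (xs := (a :: l').reverse) (by simp)
  have e' : a :: l' = (t.reverse ++ [a]) ++ s.reverse := by
    simpa using congrArg List.reverse e
  have hs0 : s ≠ [] := by
    rintro rfl
    apply hl.2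
    rw [List.head?_cons, e']
    simp
  have hhead : (t.reverse ++ [a]).head? = some a := by
    have := congrArg List.head? e'
    rw [List.head?_append_of_ne_nil _ (by simp)] at this
    exact this.symm
  have hd := hl.1
  rw [e'] at hd
  refine ⟨t.reverse ++ [a], s.reverse, ⟨hd.of_isInfix (by simp) ⟨[], _, rfl⟩, by simp [hhead]⟩,
    hd.of_isInfix (by simpa) ⟨t.reverse ++ [a], [], by simp⟩, fun y hy hy' => ?_, e'.symm⟩
  have hya : a ≠ y := by rintro rfl; exact hs (by simpa using hy')
  obtain ⟨w, hw⟩ := List.head?_eq_some_iff.1 hhead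
  cases hr : t.reverse with
  | nil => simp [hr, hya.symm] at hy
  | cons b r =>
    obtain rfl : b = a := by simpa [hr] using hhead
    have hyr : y ∈ r := by simpa [hr, hya.symm] using hy
    apply hd.2.2 b y hya
    rw [hr]
    have h1 : [b, y, b].Sublist (b :: r ++ [b]) :=
      ((List.singleton_sublist.2 hyr).append (List.Sublist.refl [b])).cons_cons b
    exact h1.append (List.singleton_sublist.2 hy')

lemma append_inj_of_isWhiteWord {u' v' : List α} (hu : IsWhiteWord α u) (hu' : IsWhiteWord α u')
    (h : u.Disjoint v) (h' : u'.Disjoint v') (e : u ++ v = u' ++ v') : u = u' ∧ v = v' := by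
  have aux : ∀ {u v u' v' x : List α}, IsWhiteWord α u → IsWhiteWord α u' → u.Disjoint v →
      u' = u ++ x → v = x ++ v' → x = [] := by
    intro u v u' v' x hu hu' hd h1 h2
    obtain ⟨a, ⟨w, rfl⟩, -⟩ := hu.eq_cons
    by_contra hx
    have h3 := hu'.2
    rw [h1, List.getLast?_append_of_ne_nil _ hx] at h3
    exact hd List.mem_cons_self (h2 ▸ List.mem_append_left _ (List.mem_of_getLast? h3.symm))
  obtain ⟨x, h1, h2⟩ | ⟨x, h1, h2⟩ := List.append_eq_append_iff.1 e
  · obtain rfl := aux hu hu' h h1 h2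
    simp_all
  · obtain rfl := aux hu' hu h' h1 h2
    simp_all

/-- Insert a word into a white word after a duplicated first letter. -/
def insertAfterHead (u v : List α) : List α := v.head?.toList ++ (u ++ v)

lemma insertAfterHead_cons (a : α) : insertAfterHead u (a :: v) = a :: (u ++ a :: v) := rfl

lemma IsLongWhiteWord.insertAfterHead (hu : IsDSWord α u) (hv : IsWhiteWord α v)
    (h : u.Disjoint v) : IsLongWhiteWord α (insertAfterHead u v) := by
  obtain ⟨a, ⟨w, rfl⟩, -⟩ := hv.eq_cons
  rw [insertAfterHead_cons]
  have hau : a ∉ u := fun ha => h ha List.mem_cons_self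
  have hd := hu.append hv.1 h
  refine ⟨⟨⟨by simp, ?_, fun x y hxy hs => ?_⟩, ?_⟩, by simp⟩
  · rw [List.isChain_cons]
    refine ⟨?_, hd.2.1⟩
    rw [List.head?_append_of_ne_nil _ hu.1]
    rintro y hy rfl
    exact hau (List.mem_of_head? hy)
  · rw [List.sublist_cons_iff] at hs
    obtain hs | ⟨r, hr, hs⟩ := hs
    · exact hd.2.2 x y hxy hs
    simp only [List.cons.injEq] at hr
    obtain ⟨rfl, rfl⟩ := hr
    obtain ⟨l₁, l₂, e, h₁, h₂⟩ := List.sublist_append_iff.1 hs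
    have key : ∀ x ∈ l₁, x ∉ l₂ := fun x hx hx' => h (h₁.subset hx) (h₂.subset hx')
    match l₁, e with
    | [], e =>
      obtain rfl : l₂ = [y, x, y] := by simpa using e.symm
      rw [List.sublist_cons_iff] at h₂
      obtain h₂ | ⟨r, hr, -⟩ := h₂
      · exact hv.1.2.2 x y hxy (h₂.cons_cons x)
      · simp only [List.cons.injEq] at hr
        exact hxy hr.1.symm
    | [_], e => grind
    | [_, _], e =>
      simp only [List.cons_append, List.nil_append, List.cons.injEq] at e
      exact hau (h₁.subset (by simp [e.2.1]))
    | [_, _, _], e =>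
      simp only [List.cons_append, List.nil_append, List.cons.injEq] at e
      exact hau (h₁.subset (by simp [e.2.1]))
    | _ :: _ :: _ :: _ :: _, e => simp at e
  · rw [← List.cons_append, List.getLast?_append_of_ne_nil _ (by simp), ← hv.2]
    simp

lemma IsLongWhiteWord.exists_insertAfterHead (hl : IsLongWhiteWord α l) :
    ∃ u v, IsDSWord α u ∧ IsWhiteWord α v ∧ u.Disjoint v ∧ _root_.insertAfterHead u v = l := by
  obtain ⟨hw, hlen⟩ := hl
  obtain ⟨a, ⟨w, rfl⟩, ⟨w', hw'⟩⟩ := hw.eq_cons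
  have haw : a ∈ w := by
    cases w' with
    | nil => simp_all
    | cons b w' =>
      simp only [List.cons_append, List.cons.injEq] at hw'
      simp [hw'.2]
  obtain ⟨u, v, rfl, hu⟩ := List.eq_append_cons_of_mem haw
  have hd := hw.1
  have hu0 : u ≠ [] := by
    rintro rfl
    simpa using hd.2.1
  refine ⟨u, a :: v, hd.of_isInfix hu0 ⟨[a], a :: v, by simp⟩,
    ⟨hd.of_isInfix (by simp) ⟨a :: u, [], by simp⟩, ?_⟩, fun y hy hy' => ?_, rfl⟩
  · have := hw.2
    rw [← List.cons_append, List.getLast?_append_of_ne_nil _ (by simp)] at this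
    rw [← this]
    simp
  · have hya : a ≠ y := by rintro rfl; exact hu hy
    have hyv : y ∈ v := by simpa [hya.symm] using hy'
    apply hd.2.2 a y hya
    exact ((List.singleton_sublist.2 hy).append
      ((List.singleton_sublist.2 hyv).cons_cons a)).cons_cons a

lemma insertAfterHead_inj {u' v' : List α} (hv : IsWhiteWord α v) (hv' : IsWhiteWord α v')
    (h : u.Disjoint v) (h' : u'.Disjoint v') (e : insertAfterHead u v = insertAfterHead u' v') :
    u = u' ∧ v = v' := by
  obtain ⟨a, ⟨w, rfl⟩, -⟩ := hv.eq_cons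
  obtain ⟨a', ⟨w', rfl⟩, -⟩ := hv'.eq_cons
  simp only [insertAfterHead_cons, List.cons.injEq] at e
  obtain ⟨rfl, e⟩ := e
  have aux : ∀ {u u' w w' x : List α}, u'.Disjoint (a :: w') → u' = u ++ x →
      a :: w = x ++ a :: w' → x = [] := by
    intro u u' w w' x hd h1 h2
    cases x with
    | nil => rfl
    | cons b x =>
      simp only [List.cons_append, List.cons.injEq] at h2
      exact (hd (a := a) (by simp [h1, h2.1]) List.mem_cons_self).elim
  obtain ⟨x, h1, h2⟩ | ⟨x, h1, h2⟩ := List.append_eq_append_iff.1 e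
  · obtain rfl := aux h' h1 h2
    simp_all
  · obtain rfl := aux h h1 h2
    simp_all

end Words

section Counting

open Finset

/-- The words in the class `Q` with set of letters `S` and degree `m`. -/
def cells (Q : ∀ α : Type, List α → Prop) {α : Type} (S : Finset α) (m : ℕ) : Set (List α) :=
  {l | Q α l ∧ (∀ a, a ∈ l ↔ a ∈ S) ∧ l.length = m + S.card}

/-- The number of words in the class `Q` of arity `k` and degree `m`. -/
noncomputable def cellCount (Q : ∀ α : Type, List α → Prop) (k m : ℕ) : ℕ :=
  (cells Q (univ : Finset (Fin k)) m).ncard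

/-- The class `Q` of words is invariant under renaming of letters. -/
def IsRelabelInvariant (Q : ∀ α : Type, List α → Prop) : Prop :=
  ∀ (α β : Type) (f : α → β) (l : List α), Function.Injective f → (Q β (l.map f) ↔ Q α l)

lemma isRelabelInvariant_isDSWord : IsRelabelInvariant IsDSWord :=
  fun _ _ _ _ hf => IsDSWord.map_iff hf

lemma isRelabelInvariant_isWhiteWord : IsRelabelInvariant IsWhiteWord :=
  fun _ _ _ _ hf => and_congr (IsDSWord.map_iff hf) (head?_map_eq_getLast?_map_iff hf)

lemma finite_cells (Q : ∀ α : Type, List α → Prop) {α : Type} [Finite α] (S : Finset α) (m : ℕ) :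
    (cells Q S m).Finite :=
  (List.finite_length_eq α (m + S.card)).subset fun _ h => h.2.2

lemma ncard_cells {Q : ∀ α : Type, List α → Prop} (hQ : IsRelabelInvariant Q) {α : Type}
    (S : Finset α) (m : ℕ) : (cells Q S m).ncard = cellCount Q S.card m := by
  set f : Fin S.card → α := fun i => (S.equivFin.symm i : α) with hf
  have hinj : Function.Injective f :=
    Subtype.val_injective.comp S.equivFin.symm.injective
  have hrange : ∀ a, (∃ i, f i = a) ↔ a ∈ S := fun a =>
    ⟨by rintro ⟨i, rfl⟩; exact (S.equivFin.symm i).2, fun ha => ⟨S.equivFin ⟨a, ha⟩, by simp [hf]⟩⟩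
  have : cells Q S m = List.map f '' cells Q (univ : Finset (Fin S.card)) m := by
    ext l
    constructor
    · rintro ⟨h1, h2, h3⟩
      have : l ∈ Set.range (List.map f) := by
        rw [Set.range_list_map]
        exact fun x hx => (hrange x).2 ((h2 x).1 hx)
      obtain ⟨l, rfl⟩ := this
      refine ⟨l, ⟨(hQ _ _ f l hinj).1 h1, fun i => ?_, by simpa using h3⟩, rfl⟩
      have := (h2 (f i)).2 ((hrange _).1 ⟨i, rfl⟩)
      simpa [hinj.eq_iff] using this
    · rintro ⟨l, ⟨h1, h2, h3⟩, rfl⟩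
      refine ⟨(hQ _ _ f l hinj).2 h1, fun a => ?_, by simpa using h3⟩
      rw [← hrange]
      simp only [mem_univ, iff_true] at h2
      simp [h2]
  rw [this, Set.ncard_image_of_injective _ (List.map_injective_iff.2 hinj), cellCount]

lemma cellCount_congr {Q R : ∀ α : Type, List α → Prop} (h : ∀ α l, Q α l ↔ R α l) (k m : ℕ) :
    cellCount Q k m = cellCount R k m := by
  simp only [cellCount, cells, h]

lemma cellCount_or {Q R : ∀ α : Type, List α → Prop} (h : ∀ α l, Q α l → ¬ R α l) (k m : ℕ) :
    cellCount (fun α l => Q α l ∨ R α l) k m = cellCount Q k m + cellCount R k m := by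
  rw [cellCount, cellCount, cellCount, ← Set.ncard_union_eq _ (finite_cells _ _ _)
    (finite_cells _ _ _)]
  · congr 1
    ext l
    simp only [cells, Set.mem_union, Set.mem_ofPred_eq]
    tauto
  · exact Set.disjoint_left.2 fun l h1 h2 => h _ _ h1.1 h2.1

/-- The product of two counting functions as a labelled convolution. -/
def labelledConv (a b : ℕ → ℕ → ℕ) (k m : ℕ) : ℕ :=
  ∑ p ∈ antidiagonal k, ∑ q ∈ antidiagonal m, k.choose p.1 * (a p.1 q.1 * b p.2 q.2)

lemma labelledConv_eq_sum_powerset (a b : ℕ → ℕ → ℕ) (k m : ℕ) :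
    labelledConv a b k m = ∑ S ∈ (univ : Finset (Fin k)).powerset, ∑ q ∈ antidiagonal m,
      a S.card q.1 * b Sᶜ.card q.2 := by
  simp only [card_compl, Fintype.card_fin]
  rw [sum_powerset_apply_card (fun j => ∑ q ∈ antidiagonal m, a j q.1 * b (k - j) q.2),
    labelledConv, Nat.sum_antidiagonal_eq_sum_range_succ_mk, card_univ, Fintype.card_fin]
  simp [mul_sum]

section Decomposition

variable {Q R T : ∀ α : Type, List α → Prop} {c : ∀ α : Type, List α → List α → List α} {s : ℕ}

lemma labelledConv_cellCount (hR : IsRelabelInvariant R) (hT : IsRelabelInvariant T)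
    (hmap : ∀ α u v, R α u → T α v → u.Disjoint v → Q α (c α u v))
    (hlen : ∀ α u v, R α u → T α v → (c α u v).length = u.length + v.length + s)
    (hmem : ∀ α u v, R α u → T α v → ∀ a, a ∈ c α u v ↔ a ∈ u ∨ a ∈ v)
    (hinj : ∀ α u v u' v', R α u → T α v → R α u' → T α v' → u.Disjoint v → u'.Disjoint v' →
      c α u v = c α u' v' → u = u' ∧ v = v')
    (hsurj : ∀ α l, Q α l → ∃ u v, R α u ∧ T α v ∧ u.Disjoint v ∧ c α u v = l) (k m : ℕ) :
    cellCount Q k (m + s) = labelledConv (cellCount R) (cellCount T) k m := by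
  classical
  rw [labelledConv_eq_sum_powerset, ← sum_product', cellCount,
    Set.ncard_eq_toFinset_card _ (finite_cells _ _ _)]
  simp_rw [← ncard_cells hR, ← ncard_cells hT, Set.ncard_eq_toFinset_card _ (finite_cells _ _ _),
    ← card_product]
  rw [← card_sigma]
  have hdisj : ∀ {S : Finset (Fin k)} {m₁ m₂ u v}, u ∈ cells R S m₁ → v ∈ cells T Sᶜ m₂ →
      u.Disjoint v := fun hu hv a ha ha' =>
    (mem_compl.1 ((hv.2.1 a).1 ha')) ((hu.2.1 a).1 ha)
  symm
  refine card_bij (fun x _ => c _ x.2.1 x.2.2) ?_ ?_ ?_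
  · rintro ⟨⟨S, m₁, m₂⟩, u, v⟩ h
    simp only [mem_sigma, mem_product, HasAntidiagonal.mem_antidiagonal, Set.Finite.mem_toFinset] at h ⊢
    obtain ⟨⟨-, hm⟩, hu, hv⟩ := h
    refine ⟨hmap _ u v hu.1 hv.1 (hdisj hu hv), fun a => ?_, ?_⟩
    · rw [hmem _ u v hu.1 hv.1, hu.2.1, hv.2.1, mem_compl]
      simp [em]
    · have := card_add_card_compl S
      rw [hlen _ u v hu.1 hv.1, hu.2.2, hv.2.2, card_univ]
      omega
  · rintro ⟨⟨S, m₁, m₂⟩, u, v⟩ h ⟨⟨S', m₁', m₂'⟩, u', v'⟩ h' e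
    simp only [mem_sigma, mem_product, HasAntidiagonal.mem_antidiagonal, Set.Finite.mem_toFinset] at h h' e
    obtain ⟨⟨-, hm⟩, hu, hv⟩ := h
    obtain ⟨⟨-, hm'⟩, hu', hv'⟩ := h'
    obtain ⟨rfl, rfl⟩ := hinj _ _ _ _ _ hu.1 hv.1 hu'.1 hv'.1 (hdisj hu hv) (hdisj hu' hv') e
    obtain rfl : S = S' := by
      ext a
      rw [← hu.2.1, ← hu'.2.1]
    obtain rfl : m₁ = m₁' := by
      have := hu.2.2
      have := hu'.2.2
      omega
    obtain rfl : m₂ = m₂' := by omega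
    rfl
  · intro l hl
    rw [Set.Finite.mem_toFinset] at hl
    obtain ⟨u, v, hu, hv, hd, rfl⟩ := hsurj _ _ hl.1
    have hv' : ∀ a, a ∈ v ↔ a ∈ (u.toFinset)ᶜ := fun a => by
      rw [mem_compl, List.mem_toFinset]
      refine ⟨fun h h' => hd h' h, fun h => ?_⟩
      exact ((hmem _ u v hu hv a).1 ((hl.2.1 a).2 (mem_univ a))).resolve_left h
    have e : v.toFinset = (u.toFinset)ᶜ := by
      ext a
      rw [← hv', List.mem_toFinset]
    have h1 := List.toFinset_card_le u
    have h2 := List.toFinset_card_le v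
    have h3 := card_add_card_compl u.toFinset
    have h4 := hl.2.2
    rw [hlen _ u v hu hv, card_univ] at h4
    rw [e] at h2
    refine ⟨⟨⟨u.toFinset, u.length - u.toFinset.card, v.length - (u.toFinset)ᶜ.card⟩, u, v⟩,
      ?_, rfl⟩
    simp only [mem_sigma, mem_product, HasAntidiagonal.mem_antidiagonal, Set.Finite.mem_toFinset, mem_powerset,
      subset_univ, true_and]
    exact ⟨by omega, ⟨hu, fun a => List.mem_toFinset.symm, by omega⟩, ⟨hv, hv', by omega⟩⟩

end Decomposition

lemma cellCount_isBlackWord (k m : ℕ) :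
    cellCount IsBlackWord k m = labelledConv (cellCount IsWhiteWord) (cellCount IsDSWord) k m :=
  labelledConv_cellCount (s := 0) (c := fun _ u v => u ++ v) isRelabelInvariant_isWhiteWord
    isRelabelInvariant_isDSWord (fun _ _ _ hu hv h => IsBlackWord.append hu hv h) (by simp)
    (by simp) (fun _ _ _ _ _ hu _ hu' _ h h' e => append_inj_of_isWhiteWord hu hu' h h' e)
    (fun _ _ h => h.exists_append) k m

lemma cellCount_isLongWhiteWord_succ (k m : ℕ) :
    cellCount IsLongWhiteWord k (m + 1) =
      labelledConv (cellCount IsDSWord) (cellCount IsWhiteWord) k m := by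
  refine labelledConv_cellCount (s := 1) (c := fun _ u v => insertAfterHead u v)
    isRelabelInvariant_isDSWord isRelabelInvariant_isWhiteWord
    (fun _ _ _ hu hv h => IsLongWhiteWord.insertAfterHead hu hv h) ?_ ?_
    (fun _ _ _ _ _ _ hv _ hv' h h' e => insertAfterHead_inj hv hv' h h' e)
    (fun _ _ h => h.exists_insertAfterHead) k m
  · intro α u v _ hv
    obtain ⟨a, ⟨w, rfl⟩, -⟩ := hv.eq_cons
    simp [insertAfterHead_cons, add_assoc]
  · intro α u v _ hv b
    obtain ⟨a, ⟨w, rfl⟩, -⟩ := hv.eq_cons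
    rw [insertAfterHead_cons]
    simp only [List.mem_cons, List.mem_append]
    tauto

lemma cellCount_isLongWhiteWord_zero (k : ℕ) : cellCount IsLongWhiteWord k 0 = 0 := by
  rw [cellCount, Set.ncard_eq_zero (finite_cells _ _ _), Set.eq_empty_iff_forall_notMem]
  rintro l ⟨hl, hmem, hlen⟩
  have hnd : l.Nodup := by
    refine Multiset.coe_nodup.1 (Multiset.dedup_card_eq_card_iff_nodup.1 ?_)
    have : (l.toFinset) = univ := by
      ext a
      simp [hmem]
    have := congrArg card this
    simpa [List.card_toFinset, hlen] using this
  obtain ⟨a, ⟨w, rfl⟩, ⟨w', hw'⟩⟩ := hl.1.eq_cons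
  cases w' with
  | nil => exact hl.2 (by simp_all)
  | cons b w' =>
    simp only [List.cons_append, List.cons.injEq] at hw'
    simp [hw'.2] at hnd

lemma cellCount_isSingletonWord (k m : ℕ) :
    cellCount IsSingletonWord k m = if k = 1 ∧ m = 0 then 1 else 0 := by
  split_ifs with h
  · obtain ⟨rfl, rfl⟩ := h
    rw [cellCount, Set.ncard_eq_one]
    refine ⟨[0], ?_⟩
    ext l
    simp only [cells, IsSingletonWord, List.length_eq_one_iff, Set.mem_ofPred_eq,
      Set.mem_singleton_iff]
    constructor
    · rintro ⟨⟨a, rfl⟩, -⟩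
      rw [Subsingleton.elim a 0]
    · rintro rfl
      exact ⟨⟨0, rfl⟩, fun a => by simp [Subsingleton.elim a 0], by simp⟩
  · rw [cellCount, Set.ncard_eq_zero (finite_cells _ _ _), Set.eq_empty_iff_forall_notMem]
    rintro l ⟨hl, hmem, hlen⟩
    rw [hl, card_univ, Fintype.card_fin] at hlen
    obtain ⟨a, rfl⟩ := List.length_eq_one_iff.1 hl
    have := a.pos
    omega

lemma cellCount_isDSWord (k m : ℕ) :
    cellCount IsDSWord k m = cellCount IsBlackWord k m + cellCount IsWhiteWord k m := by
  rw [← cellCount_or fun _ _ h h' => h.2 h'.2]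
  exact cellCount_congr (fun α l => by unfold IsBlackWord IsWhiteWord; tauto) k m

lemma cellCount_isWhiteWord (k m : ℕ) :
    cellCount IsWhiteWord k m = cellCount IsSingletonWord k m + cellCount IsLongWhiteWord k m := by
  rw [← cellCount_or fun _ _ h h' => h'.2 h]
  refine cellCount_congr (fun α l => ⟨fun h => ?_, ?_⟩) k m
  · by_cases h' : l.length = 1
    · exact Or.inl h'
    · exact Or.inr ⟨h, h'⟩
  · rintro (h | h)
    · obtain ⟨a, rfl⟩ := List.length_eq_one_iff.1 h
      refine ⟨⟨by simp, by simp, fun x y _ hs => ?_⟩, rfl⟩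
      simpa using hs.length_le
    · exact h.1

end Counting

section Encoding

variable {k m : ℕ}

lemma isDSWord_ofFn_iff {f : Fin (m + k) → Fin k} (hk : k ≠ 0) :
    IsDSWord _ (List.ofFn f) ↔
      (∀ a : ℕ, ∀ ha : a + 1 < m + k, f ⟨a, by omega⟩ ≠ f ⟨a + 1, ha⟩) ∧
      ¬∃ a b c d : Fin (m + k), a < b ∧ b < c ∧ c < d ∧ f a = f c ∧ f b = f d ∧ f a ≠ f b := by
  unfold IsDSWord
  rw [List.isChain_ofFn]
  constructor
  · rintro ⟨-, h1, h2⟩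
    refine ⟨h1, ?_⟩
    rintro ⟨a, b, c, d, hab, hbc, hcd, hac, hbd, hne⟩
    apply h2 _ _ hne
    have : [f a, f b, f a, f b] = [a, b, c, d].map f := by simp [hac, hbd]
    rw [this, List.ofFn_eq_map]
    refine List.Sublist.map f ?_
    have hlt : [a, b, c, d].SortedLT := by
      simp only [List.sortedLT_iff_pairwise, List.pairwise_cons, List.mem_cons]
      grind
    exact List.sublist_of_subperm_of_sortedLE (hlt.nodup.subperm fun _ _ => List.mem_finRange _)
      hlt.sortedLE (List.sortedLT_finRange _).sortedLE
  · rintro ⟨h1, h2⟩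
    refine ⟨by simp; omega, h1, fun a b hab hs => h2 ?_⟩
    rw [List.ofFn_eq_map] at hs
    obtain ⟨l', hl', h'⟩ := List.sublist_map_iff.1 hs
    have hlen : l'.length = 4 := by simpa using (congrArg List.length h').symm
    have hlt := (List.sortedLT_finRange (m + k)).pairwise.sublist hl'
    match l', hlen with
    | [p, q, r, s], _ =>
      simp only [List.map_cons, List.map_nil, List.cons.injEq, and_true] at h'
      simp only [List.pairwise_cons, List.mem_cons] at hlt
      grind

lemma image_ofFn_eq_cells {Q : ∀ α : Type, List α → Prop} {p : (Fin (m + k) → Fin k) → Prop}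
    (h : ∀ f, Function.Surjective f ∧ Q _ (List.ofFn f) ↔ p f) :
    List.ofFn '' {f | p f} = cells Q Finset.univ m := by
  ext l
  constructor
  · rintro ⟨f, hf, rfl⟩
    obtain ⟨h1, h2⟩ := (h f).2 hf
    exact ⟨h2, fun a => by simpa [List.mem_ofFn] using h1 a, by simp⟩
  · rintro ⟨h1, h2, h3⟩
    rw [Finset.card_univ, Fintype.card_fin] at h3
    have e : List.ofFn (fun i : Fin (m + k) => l[i]) = l := by
      apply List.ext_getElem <;> simp [h3]
    refine ⟨fun i => l[i], (h _).1 ⟨fun a => ?_, by rwa [e]⟩, e⟩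
    have := (h2 a).2 (Finset.mem_univ a)
    rwa [← e, List.mem_ofFn] at this

lemma natCard_eq_cellCount {Q : ∀ α : Type, List α → Prop} {p : (Fin (m + k) → Fin k) → Prop}
    (h : ∀ f, Function.Surjective f ∧ Q _ (List.ofFn f) ↔ p f) :
    Nat.card {f // p f} = cellCount Q k m := by
  rw [cellCount, ← image_ofFn_eq_cells h, Set.ncard_image_of_injective _ List.ofFn_injective]
  rfl

lemma dsCount_eq_cellCount (hk : k ≠ 0) : dsCount k m = cellCount IsDSWord k m :=
  natCard_eq_cellCount fun _ => by rw [isDSWord_ofFn_iff hk, IsDSSurjection]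

lemma head?_ofFn_eq_getLast?_ofFn_iff {f : Fin (m + k) → Fin k} :
    (List.ofFn f).head? = (List.ofFn f).getLast? ↔ IsWhiteBoundary k m f := by
  rw [List.head?_eq_getElem?, List.getLast?_eq_getElem?, IsWhiteBoundary, List.length_ofFn]
  by_cases h : 0 < m + k
  · simp [h]
  · obtain ⟨rfl, rfl⟩ : m = 0 ∧ k = 0 := by omega
    simp

lemma whiteCount_eq_cellCount (hk : k ≠ 0) : whiteCount k m = cellCount IsWhiteWord k m :=
  natCard_eq_cellCount fun _ => by
    rw [IsWhiteWord, isDSWord_ofFn_iff hk, head?_ofFn_eq_getLast?_ofFn_iff, IsDSSurjection]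
    tauto

lemma blackCount_eq_cellCount (hk : k ≠ 0) : blackCount k m = cellCount IsBlackWord k m :=
  natCard_eq_cellCount fun f => by
    have : IsBlackBoundary k m f ↔ ¬ IsWhiteBoundary k m f := by
      simp only [IsBlackBoundary, IsWhiteBoundary]
      have : 0 < m + k := by omega
      simp [this]
    rw [IsBlackWord, isDSWord_ofFn_iff hk, Ne, head?_ofFn_eq_getLast?_ofFn_iff, this,
      IsDSSurjection]
    tauto

end Encoding

section GeneratingFunction

open Finset MvPowerSeries

/-- The generating function of `a`, exponential in variable `0` and ordinary in variable `1`. -/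
noncomputable def mixedGF (a : ℕ → ℕ → ℕ) : MvPowerSeries (Fin 2) ℚ :=
  fun d => (a (d 0) (d 1) : ℚ) / (Nat.factorial (d 0) : ℚ)

lemma coeff_mixedGF (a : ℕ → ℕ → ℕ) (d : Fin 2 →₀ ℕ) :
    coeff d (mixedGF a) = (a (d 0) (d 1) : ℚ) / (Nat.factorial (d 0) : ℚ) := rfl

lemma mixedGF_add (a b : ℕ → ℕ → ℕ) :
    mixedGF (fun k m => a k m + b k m) = mixedGF a + mixedGF b := by
  ext d
  simp [coeff_mixedGF, add_div]

lemma sum_antidiagonal_finsupp_fin_two {M : Type*} [AddCommMonoid M] (d : Fin 2 →₀ ℕ)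
    (F : ℕ × ℕ → ℕ × ℕ → M) :
    ∑ p ∈ antidiagonal d, F (p.1 0, p.2 0) (p.1 1, p.2 1) =
      ∑ p ∈ antidiagonal (d 0), ∑ q ∈ antidiagonal (d 1), F p q := by
  rw [← sum_product']
  refine sum_nbij' (fun p => ((p.1 0, p.2 0), (p.1 1, p.2 1)))
    (fun x => (Finsupp.equivFunOnFinite.symm ![x.1.1, x.2.1],
      Finsupp.equivFunOnFinite.symm ![x.1.2, x.2.2])) ?_ ?_ ?_ ?_ ?_
  · simp only [HasAntidiagonal.mem_antidiagonal, mem_product]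
    rintro p rfl
    simp
  · simp only [HasAntidiagonal.mem_antidiagonal, mem_product]
    rintro x ⟨h0, h1⟩
    ext i
    fin_cases i <;> simpa
  · rintro p -
    ext i <;> fin_cases i <;> simp
  · rintro x -
    simp
  · rintro p -
    rfl

lemma mixedGF_labelledConv (a b : ℕ → ℕ → ℕ) :
    mixedGF (labelledConv a b) = mixedGF a * mixedGF b := by
  ext d
  rw [coeff_mul]
  simp only [coeff_mixedGF]
  rw [sum_antidiagonal_finsupp_fin_two d (fun p q => (a p.1 q.1 : ℚ) / (Nat.factorial p.1 : ℚ) *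
    ((b p.2 q.2 : ℚ) / (Nat.factorial p.2 : ℚ))), labelledConv]
  push_cast
  simp only [sum_div]
  refine sum_congr rfl fun p hp => sum_congr rfl fun q _ => ?_
  rw [HasAntidiagonal.mem_antidiagonal] at hp
  rw [← hp, Nat.cast_add_choose]
  have := Nat.factorial_ne_zero (p.1 + p.2)
  field_simp

lemma mixedGF_shift {a b : ℕ → ℕ → ℕ} (h0 : ∀ k, a k 0 = 0) (hs : ∀ k m, a k (m + 1) = b k m) :
    mixedGF a = X 1 * mixedGF b := by
  ext d
  rw [X, coeff_monomial_mul]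
  split_ifs with h
  · have h1 : 1 ≤ d 1 := by simpa using h 1
    obtain ⟨n, hn⟩ := Nat.exists_eq_add_of_le' h1
    simp [coeff_mixedGF, hn, hs]
  · have h1 : d 1 = 0 := by
      by_contra h1
      refine h fun i => ?_
      fin_cases i
      · simp
      · simpa using Nat.one_le_iff_ne_zero.2 h1
    simp [coeff_mixedGF, h1, h0]

lemma mixedGF_isSingletonWord : mixedGF (cellCount IsSingletonWord) = X 0 := by
  ext d
  rw [coeff_mixedGF, cellCount_isSingletonWord, coeff_X]
  have : d = Finsupp.single 0 1 ↔ d 0 = 1 ∧ d 1 = 0 := by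
    rw [Finsupp.ext_iff, Fin.forall_fin_two]
    simp
  simp only [this]
  split_ifs with h
  · simp [h.1]
  · simp

lemma cellCount_zero_left {Q : ∀ α : Type, List α → Prop} (h : ∀ α l, Q α l → l ≠ []) (m : ℕ) :
    cellCount Q 0 m = 0 := by
  rw [cellCount, Set.ncard_eq_zero (finite_cells _ _ _), Set.eq_empty_iff_forall_notMem]
  rintro l ⟨hl, -⟩
  exact h _ _ hl (Subsingleton.elim _ _)

lemma eq_mixedGF {Q : ∀ α : Type, List α → Prop} (h : ∀ α l, Q α l → l ≠ []) {c : ℕ → ℕ → ℕ}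
    (hc : ∀ k m, k ≠ 0 → c k m = cellCount Q k m) :
    (fun d => if d 0 = 0 then 0 else (c (d 0) (d 1) : ℚ) / (Nat.factorial (d 0) : ℚ) :
      MvPowerSeries (Fin 2) ℚ) = mixedGF (cellCount Q) := by
  funext d
  simp only [mixedGF]
  split_ifs with hd
  · simp [hd, cellCount_zero_left h]
  · rw [hc _ _ hd]

lemma cactiGF_eq_mixedGF : cactiGF = mixedGF (cellCount IsDSWord) :=
  eq_mixedGF (fun _ _ h => h.1) fun _ _ => dsCount_eq_cellCount

lemma blackGF_eq_mixedGF : blackGF = mixedGF (cellCount IsBlackWord) :=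
  eq_mixedGF (fun _ _ h => h.1.1) fun _ _ => blackCount_eq_cellCount

lemma whiteGF_eq_mixedGF : whiteGF = mixedGF (cellCount IsWhiteWord) :=
  eq_mixedGF (fun _ _ h => h.1.1) fun _ _ => whiteCount_eq_cellCount

lemma cactiGF_eq_blackGF_add_whiteGF : cactiGF = blackGF + whiteGF := by
  rw [cactiGF_eq_mixedGF, blackGF_eq_mixedGF, whiteGF_eq_mixedGF, ← mixedGF_add]
  congr 1
  funext k m
  exact cellCount_isDSWord k m

lemma blackGF_eq_whiteGF_mul_cactiGF : blackGF = whiteGF * cactiGF := by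
  rw [cactiGF_eq_mixedGF, blackGF_eq_mixedGF, whiteGF_eq_mixedGF, ← mixedGF_labelledConv]
  congr 1
  funext k m
  exact cellCount_isBlackWord k m

lemma whiteGF_eq_X_add : whiteGF = X 0 + X 1 * (cactiGF * whiteGF) := by
  rw [cactiGF_eq_mixedGF, whiteGF_eq_mixedGF, ← mixedGF_labelledConv,
    ← mixedGF_shift cellCount_isLongWhiteWord_zero cellCount_isLongWhiteWord_succ,
    ← mixedGF_isSingletonWord, ← mixedGF_add]
  congr 1
  funext k m
  exact cellCount_isWhiteWord k m

end GeneratingFunction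

open MvPowerSeries in
/-- The generating functions of black and white cacti cells satisfy
`P = B + W`, `B·(1 - W) = W²` and `W·(1 - t·P) = x`. -/
theorem black_white_relations :
    cactiGF = blackGF + whiteGF ∧
    blackGF * (1 - whiteGF) = whiteGF ^ 2 ∧
    whiteGF * (1 - X 1 * cactiGF) = X 0 := by
  refine ⟨cactiGF_eq_blackGF_add_whiteGF, ?_, ?_⟩
  · have h := blackGF_eq_whiteGF_mul_cactiGF
    rw [cactiGF_eq_blackGF_add_whiteGF] at h
    linear_combination h
  · linear_combination whiteGF_eq_X_add
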